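/- Let X be a compact metric space and f : X → X a continuous map. If the map ω_f : X → 2^X, x ↦ ω_f(x), is continuous (with respect to the Hausdorff metric on nonempty closed subsets of X), then for every x ∈ X the set ω_f(x) is a minimal set of f. -/

import Mathlib

open Set Filter Metric Topology

/-- The defining condition of a regular curve: every point has arbitrarily small
open neighborhoods with finite boundary. (Together with the instance assumptions
`Nonempty`, `CompactSpace`, `ConnectedSpace` on a metric space, this says `X` is a
regular curve.) -/
def regularCurveAx (X : Type*) [MetricSpace X] : Prop :=
  ∀ (x : X) (V : Set X), IsOpen V → x ∈ V →
    ∃ U : Set X, IsOpen U ∧ x ∈ U ∧ U ⊆ V ∧ (frontier U).Finite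

/-- The ω-limit set of `x` under `f`: all limits of `f^[n i] x` along a strictly
increasing sequence of integers `n`. -/
def omegaSet {X : Type*} [MetricSpace X] (f : X → X) (x : X) : Set X :=
  {y | ∃ n : ℕ → ℕ, StrictMono n ∧ Tendsto (fun i => f^[n i] x) atTop (𝓝 y)}

/-- `M` is a minimal set of `f`: nonempty, closed, strongly invariant, and without
any proper nonempty closed strongly invariant subset. -/
def IsMinimalSet {X : Type*} [MetricSpace X] (f : X → X) (M : Set X) : Prop :=
  M.Nonempty ∧ IsClosed M ∧ f '' M = M ∧
    ∀ N : Set X, N ⊆ M → N.Nonempty → IsClosed N → f '' N = N → N = M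

section OmegaSet

variable {X : Type*} [MetricSpace X] {f : X → X} {x y : X}

theorem omegaSet_eq_setOf_mapClusterPt (f : X → X) (x : X) :
    omegaSet f x = {y | MapClusterPt y atTop fun n => f^[n] x} := by
  ext y
  constructor
  · rintro ⟨n, hn, hy⟩
    exact hy.mapClusterPt.of_comp hn.tendsto_atTop
  · intro hy
    obtain ⟨n, hn, hy⟩ := hy.tendsto_subseq
    exact ⟨n, hn, hy⟩

theorem isClosed_omegaSet (f : X → X) (x : X) : IsClosed (omegaSet f x) := by
  rw [omegaSet_eq_setOf_mapClusterPt]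
  exact isClosed_setOfPred_clusterPt

theorem omegaSet_nonempty [CompactSpace X] (f : X → X) (x : X) : (omegaSet f x).Nonempty := by
  obtain ⟨y, n, hn, hy⟩ := CompactSpace.tendsto_subseq fun n => f^[n] x
  exact ⟨y, n, hn, hy⟩

theorem omegaSet_apply (f : X → X) (x : X) : omegaSet f (f x) = omegaSet f x := by
  ext y
  constructor
  · rintro ⟨n, hn, hy⟩
    exact ⟨fun i => n i + 1, fun i j h => Nat.succ_lt_succ (hn h), hy⟩
  · rintro ⟨n, hn, hy⟩
    have hpos (i : ℕ) : 1 ≤ n (i + 1) := (Nat.le_add_left 1 i).trans hn.le_apply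
    refine ⟨fun i => n (i + 1) - 1, fun i j h => ?_, ?_⟩
    · have := hn (Nat.succ_lt_succ h)
      have := hpos i
      grind
    · refine (hy.comp (tendsto_add_atTop_nat 1)).congr fun i => ?_
      rw [Function.comp_apply, ← Function.iterate_succ_apply, Nat.succ_eq_add_one,
        Nat.sub_add_cancel (hpos i)]

theorem omegaSet_iterate (f : X → X) (x : X) (n : ℕ) : omegaSet f (f^[n] x) = omegaSet f x := by
  induction n with
  | zero => rfl
  | succ n ih => rw [Function.iterate_succ_apply', omegaSet_apply, ih]

theorem image_omegaSet [CompactSpace X] (hf : Continuous f) (x : X) :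
    f '' omegaSet f x = omegaSet f x := by
  apply Subset.antisymm
  · rintro _ ⟨y, ⟨n, hn, hy⟩, rfl⟩
    refine ⟨fun i => n i + 1, fun i j h => Nat.succ_lt_succ (hn h), ?_⟩
    simpa only [Function.iterate_succ_apply'] using! (hf.tendsto y).comp hy
  · intro y hy
    rw [← omegaSet_apply] at hy
    obtain ⟨n, hn, hy⟩ := hy
    obtain ⟨z, k, hk, hz⟩ := CompactSpace.tendsto_subseq fun i => f^[n i] x
    refine ⟨z, ⟨n ∘ k, hn.comp hk, hz⟩, tendsto_nhds_unique ((hf.tendsto z).comp hz) ?_⟩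
    refine (hy.comp hk.tendsto_atTop).congr fun i => ?_
    simp only [Function.comp_apply, ← Function.iterate_succ_apply, Function.iterate_succ_apply']

theorem omegaSet_subset_of_mapsTo {N : Set X} (hN : IsClosed N) (hfN : MapsTo f N N)
    (hx : x ∈ N) : omegaSet f x ⊆ N := by
  rintro y ⟨n, -, hy⟩
  exact hN.mem_of_tendsto hy (Eventually.of_forall fun i => hfN.iterate (n i) hx)

theorem omegaSet_eq_of_mem_omegaSet [CompactSpace X]
    (hcont : ∀ x : X, ∀ ε > 0, ∃ δ > 0, ∀ y : X, dist y x < δ →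
      hausdorffDist (omegaSet f y) (omegaSet f x) < ε)
    (hy : y ∈ omegaSet f x) : omegaSet f x = omegaSet f y := by
  have hdist : hausdorffDist (omegaSet f x) (omegaSet f y) = 0 := by
    refine le_antisymm (le_of_forall_pos_lt_add fun ε hε => ?_) hausdorffDist_nonneg
    obtain ⟨δ, hδ, h⟩ := hcont y ε hε
    obtain ⟨n, -, hn⟩ := hy
    obtain ⟨i, hi⟩ := (hn.eventually (ball_mem_nhds y hδ)).exists
    simpa only [omegaSet_iterate, zero_add] using h _ hi
  refine ((isClosed_omegaSet f x).hausdorffDist_zero_iff_eq (isClosed_omegaSet f y) ?_).1 hdist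
  exact hausdorffEDist_ne_top_of_nonempty_of_bounded (omegaSet_nonempty f x)
    (omegaSet_nonempty f y) (isClosed_omegaSet f x).isCompact.isBounded
    (isClosed_omegaSet f y).isCompact.isBounded

end OmegaSet

/-- If the map x ↦ ω_f(x) is continuous for the Hausdorff metric, then every
ω-limit set is minimal. -/
theorem omegaSet_minimal_of_omegaMap_continuous {X : Type*} [MetricSpace X]
    [CompactSpace X] (f : X → X) (hf : Continuous f)
    (hcont : ∀ x : X, ∀ ε > 0, ∃ δ > 0, ∀ y : X, dist y x < δ →
      hausdorffDist (omegaSet f y) (omegaSet f x) < ε) :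
    ∀ x : X, IsMinimalSet f (omegaSet f x) := by
  intro x
  refine ⟨omegaSet_nonempty f x, isClosed_omegaSet f x, image_omegaSet hf x, ?_⟩
  rintro N hNx ⟨y, hy⟩ hN hfN
  refine hNx.antisymm ?_
  rw [omegaSet_eq_of_mem_omegaSet hcont (hNx hy)]
  exact omegaSet_subset_of_mapsTo hN (mapsTo_iff_image_subset.2 hfN.subset) hy
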